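/- Wasserstein stability of max-plus polynomials on barcode space: let 𝒟 be the smallest set of functions from barcodes to ℝ containing all constant functions and the functions σ_{(0,1)^n} for every n ≥ 1, and closed under pointwise addition and pointwise maximum. Then for every F ∈ 𝒟 and every real p ≥ 1 there exists a constant C ≥ 0 such that |F(B_1) − F(B_2)| ≤ C · d_p(B_1, B_2) for every pair of barcodes B_1 and B_2. -/

import Mathlib

/-- Distance between two intervals given as (left endpoint, length):
`d_∞((x₁,d₁),(x₂,d₂)) = max(|x₁ − x₂|, |d₁ − d₂ + x₁ − x₂|)`. -/
def intervalDist (I J : ℝ × ℝ) : ℝ := max |I.1 - J.1| |I.2 - J.2 + I.1 - J.1|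

/-- A partial matching between two barcodes (finite multisets of intervals), encoded
as a multiset of matched pairs: the first components form a submultiset of `B₁`, the
second components a submultiset of `B₂`. -/
def IsMatching (B₁ B₂ : Multiset (ℝ × ℝ)) (M : Multiset ((ℝ × ℝ) × (ℝ × ℝ))) : Prop :=
  M.map Prod.fst ≤ B₁ ∧ M.map Prod.snd ≤ B₂

/-- The bottleneck penalty `P_∞(θ)` of a partial matching: the maximum of the interval
distances of matched pairs and of `d/2` over all unmatched intervals `(x, d)`. -/
noncomputable def penaltyInf (B₁ B₂ : Multiset (ℝ × ℝ))
    (M : Multiset ((ℝ × ℝ) × (ℝ × ℝ))) : ℝ :=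
  ((M.map fun IJ : (ℝ × ℝ) × (ℝ × ℝ) => intervalDist IJ.1 IJ.2) +
      (((B₁ - M.map Prod.fst) + (B₂ - M.map Prod.snd)).map
        fun I : ℝ × ℝ => I.2 / 2)).fold max 0

/-- The bottleneck distance between two barcodes. -/
noncomputable def bottleneckDist (B₁ B₂ : Multiset (ℝ × ℝ)) : ℝ :=
  sInf { r | ∃ M, IsMatching B₁ B₂ M ∧ r = penaltyInf B₁ B₂ M }

/-- The `q`-th Wasserstein penalty `P_q(θ)` of a partial matching. -/
noncomputable def penaltyP (q : ℝ) (B₁ B₂ : Multiset (ℝ × ℝ))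
    (M : Multiset ((ℝ × ℝ) × (ℝ × ℝ))) : ℝ :=
  (M.map fun IJ : (ℝ × ℝ) × (ℝ × ℝ) => intervalDist IJ.1 IJ.2 ^ q).sum +
    ((((B₁ - M.map Prod.fst) + (B₂ - M.map Prod.snd)).map
      fun I : ℝ × ℝ => (I.2 / 2) ^ q)).sum

/-- The `q`-th Wasserstein distance between two barcodes. -/
noncomputable def wassersteinDist (q : ℝ) (B₁ B₂ : Multiset (ℝ × ℝ)) : ℝ :=
  (sInf { r | ∃ M, IsMatching B₁ B₂ M ∧ r = penaltyP q B₁ B₂ M }) ^ (1 / q)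

/-- `sigmaN n B` = `σ_{(0,1)ⁿ}(B)`: the sum of the `n` largest lengths of intervals
of `B` (for barcodes, i.e. multisets of pairs of nonnegative reals, the supremum below
is exactly the sum of the `n` largest lengths, counting missing intervals as 0). -/
noncomputable def sigmaN (n : ℕ) (B : Multiset (ℝ × ℝ)) : ℝ :=
  sSup { r | ∃ s : Multiset ℝ, s ≤ B.map Prod.snd ∧ s.card ≤ n ∧ r = s.sum }

/-- A barcode: a finite multiset of intervals `(x, d) ∈ [0,∞) × [0,∞)`. -/
def Barcode : Type := { B : Multiset (ℝ × ℝ) // ∀ I ∈ B, 0 ≤ I.1 ∧ 0 ≤ I.2 }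

/-- The smallest set of functions from barcodes to `ℝ` containing all constant
functions and the functions `σ_{(0,1)ⁿ}` for every `n ≥ 1`, and closed under pointwise
addition and pointwise maximum. -/
inductive MemD : (Barcode → ℝ) → Prop
  | const (c : ℝ) : MemD (fun _ => c)
  | sigma (n : ℕ) (hn : 1 ≤ n) : MemD (fun B => sigmaN n B.1)
  | add {f g} : MemD f → MemD g → MemD (fun B => f B + g B)
  | max {f g} : MemD f → MemD g → MemD (fun B => max (f B) (g B))

/-- A submultiset of an image is the image of a submultiset. -/
theorem Multiset.exists_le_map_eq_of_le_map {α β : Type*} {f : α → β} {s : Multiset β}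
    {t : Multiset α} (h : s ≤ t.map f) : ∃ u ≤ t, u.map f = s := by
  induction t using Quotient.inductionOn with | _ l
  induction s using Quotient.inductionOn with | _ l'
  obtain ⟨l₁, hperm, hsub⟩ : l'.Subperm (l.map f) := h
  obtain ⟨l₂, hl₂, rfl⟩ := List.sublist_map_iff.1 hsub
  exact ⟨l₂, Multiset.coe_le.2 hl₂.subperm, Multiset.coe_eq_coe.2 hperm⟩

theorem intervalDist_nonneg (I J : ℝ × ℝ) : 0 ≤ intervalDist I J :=
  (abs_nonneg _).trans (le_max_left _ _)

theorem abs_snd_sub_snd_le_two_mul_intervalDist (I J : ℝ × ℝ) :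
    |I.2 - J.2| ≤ 2 * intervalDist I J := by
  have h₁ : |I.1 - J.1| ≤ intervalDist I J := le_max_left _ _
  have h₂ : |I.2 - J.2 + I.1 - J.1| ≤ intervalDist I J := le_max_right _ _
  rw [abs_le] at *
  constructor <;> linarith

theorem bddAbove_sigmaN_set (n : ℕ) (B : Multiset (ℝ × ℝ)) :
    BddAbove { r : ℝ | ∃ s : Multiset ℝ, s ≤ B.map Prod.snd ∧ s.card ≤ n ∧ r = s.sum } := by
  refine (((B.map Prod.snd).powerset.map Multiset.sum).toFinset.finite_toSet.subset ?_).bddAbove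
  rintro _ ⟨s, hs, -, rfl⟩
  simp only [Finset.mem_coe, Multiset.mem_toFinset]
  exact Multiset.mem_map_of_mem _ (Multiset.mem_powerset.2 hs)

/-- If a matching moves lengths by at most `c` and leaves unmatched only intervals of `B₁` of
length at most `c`, then the sum of the `n` largest lengths drops by at most `n * c`. -/
theorem sigmaN_le_add_of_isMatching {n : ℕ} {B₁ B₂ : Multiset (ℝ × ℝ)}
    {M : Multiset ((ℝ × ℝ) × (ℝ × ℝ))} {c : ℝ} (hM : IsMatching B₁ B₂ M) (hc : 0 ≤ c)
    (hmatched : ∀ IJ ∈ M, IJ.1.2 ≤ IJ.2.2 + c)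
    (hunmatched : ∀ I ∈ B₁ - M.map Prod.fst, I.2 ≤ c) :
    sigmaN n B₁ ≤ sigmaN n B₂ + n * c := by
  refine csSup_le ⟨0, 0, Multiset.zero_le _, by simp, by simp⟩ ?_
  rintro _ ⟨_, hs, hcard, rfl⟩
  obtain ⟨S, hS, rfl⟩ := Multiset.exists_le_map_eq_of_le_map hs
  obtain ⟨N, hN, hNS⟩ := Multiset.exists_le_map_eq_of_le_map
    (Multiset.inter_le_right : S ∩ M.map Prod.fst ≤ M.map Prod.fst)
  have hsplit : S = (S - M.map Prod.fst) + N.map Prod.fst := by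
    rw [hNS, Multiset.sub_add_inter]
  have hScard : (S - M.map Prod.fst).card + N.card = S.card := by
    conv_rhs => rw [hsplit]
    simp
  rw [Multiset.card_map] at hcard
  have hle : (N.map fun IJ => IJ.2.2).sum ≤ sigmaN n B₂ := by
    refine le_csSup (bddAbove_sigmaN_set n B₂) ⟨_, ?_, ?_, rfl⟩
    · have := Multiset.map_le_map (f := Prod.snd) ((Multiset.map_le_map hN).trans hM.2)
      simpa [Multiset.map_map] using this
    · rw [Multiset.card_map]
      lia
  have hmat : (N.map fun IJ => IJ.1.2).sum ≤ (N.map fun IJ => IJ.2.2).sum + N.card * c := by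
    have := Multiset.sum_map_le_sum_map (s := N) (fun IJ => IJ.1.2) (fun IJ => IJ.2.2 + c)
      fun IJ h => hmatched IJ (Multiset.mem_of_le hN h)
    simpa [Multiset.sum_map_add] using this
  have hunm : ((S - M.map Prod.fst).map Prod.snd).sum ≤ (S - M.map Prod.fst).card * c := by
    have := Multiset.sum_map_le_sum_map (s := S - M.map Prod.fst) Prod.snd (fun _ => c)
      fun I h => hunmatched I (Multiset.mem_of_le (tsub_le_tsub_right hS _) h)
    simpa using this
  have hsum : (S.map Prod.snd).sum
      = ((S - M.map Prod.fst).map Prod.snd).sum + (N.map fun IJ => IJ.1.2).sum := by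
    conv_lhs => rw [hsplit]
    simp [Multiset.map_map]
  have hn : (((S - M.map Prod.fst).card : ℝ) + N.card) * c ≤ n * c := by
    gcongr
    exact_mod_cast hScard.trans_le hcard
  linarith

theorem IsMatching.swap {B₁ B₂ : Multiset (ℝ × ℝ)} {M : Multiset ((ℝ × ℝ) × (ℝ × ℝ))}
    (hM : IsMatching B₁ B₂ M) : IsMatching B₂ B₁ (M.map Prod.swap) := by
  simpa [IsMatching, Multiset.map_map, Function.comp_def] using And.symm hM

theorem sum_intervalDist_rpow_nonneg (p : ℝ) (M : Multiset ((ℝ × ℝ) × (ℝ × ℝ))) :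
    0 ≤ (M.map fun IJ : (ℝ × ℝ) × (ℝ × ℝ) => intervalDist IJ.1 IJ.2 ^ p).sum := by
  refine Multiset.sum_nonneg fun x hx => ?_
  obtain ⟨IJ, -, rfl⟩ := Multiset.mem_map.1 hx
  exact Real.rpow_nonneg (intervalDist_nonneg _ _) _

theorem sum_half_length_rpow_nonneg (p : ℝ) {B : Multiset (ℝ × ℝ)} (hB : ∀ I ∈ B, 0 ≤ I.2) :
    0 ≤ (B.map fun I : ℝ × ℝ => (I.2 / 2) ^ p).sum := by
  refine Multiset.sum_nonneg fun x hx => ?_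
  obtain ⟨I, hI, rfl⟩ := Multiset.mem_map.1 hx
  have := hB I hI
  positivity

theorem snd_nonneg_of_mem_unmatched {B₁ B₂ A₁ A₂ : Multiset (ℝ × ℝ)}
    (h₁ : ∀ I ∈ B₁, 0 ≤ I.2) (h₂ : ∀ I ∈ B₂, 0 ≤ I.2) :
    ∀ I ∈ (B₁ - A₁) + (B₂ - A₂), 0 ≤ I.2 := fun I hI =>
  (Multiset.mem_add.1 hI).elim (fun h => h₁ I (Multiset.mem_of_le tsub_le_self h))
    (fun h => h₂ I (Multiset.mem_of_le tsub_le_self h))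

section Penalty

variable {p : ℝ} {B₁ B₂ : Multiset (ℝ × ℝ)} {M : Multiset ((ℝ × ℝ) × (ℝ × ℝ))}

theorem penaltyP_nonneg (h₁ : ∀ I ∈ B₁, 0 ≤ I.2) (h₂ : ∀ I ∈ B₂, 0 ≤ I.2) :
    0 ≤ penaltyP p B₁ B₂ M :=
  add_nonneg (sum_intervalDist_rpow_nonneg p M)
    (sum_half_length_rpow_nonneg p (snd_nonneg_of_mem_unmatched h₁ h₂))

theorem intervalDist_rpow_le_penaltyP (h₁ : ∀ I ∈ B₁, 0 ≤ I.2) (h₂ : ∀ I ∈ B₂, 0 ≤ I.2)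
    {IJ : (ℝ × ℝ) × (ℝ × ℝ)} (hIJ : IJ ∈ M) :
    intervalDist IJ.1 IJ.2 ^ p ≤ penaltyP p B₁ B₂ M := by
  have hrest := sum_half_length_rpow_nonneg p
    (snd_nonneg_of_mem_unmatched (A₁ := M.map Prod.fst) (A₂ := M.map Prod.snd) h₁ h₂)
  refine le_trans ?_ (le_add_of_nonneg_right hrest)
  obtain ⟨N, rfl⟩ := Multiset.exists_cons_of_mem hIJ
  rw [Multiset.map_cons, Multiset.sum_cons]
  exact le_add_of_nonneg_right (sum_intervalDist_rpow_nonneg p N)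

theorem half_length_rpow_le_penaltyP (h₁ : ∀ I ∈ B₁, 0 ≤ I.2) (h₂ : ∀ I ∈ B₂, 0 ≤ I.2)
    {I : ℝ × ℝ} (hI : I ∈ (B₁ - M.map Prod.fst) + (B₂ - M.map Prod.snd)) :
    (I.2 / 2) ^ p ≤ penaltyP p B₁ B₂ M := by
  refine le_trans ?_ (le_add_of_nonneg_left (sum_intervalDist_rpow_nonneg p M))
  have hnn := snd_nonneg_of_mem_unmatched (A₁ := M.map Prod.fst) (A₂ := M.map Prod.snd) h₁ h₂
  obtain ⟨N, hN⟩ := Multiset.exists_cons_of_mem hI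
  rw [hN] at hnn ⊢
  rw [Multiset.map_cons, Multiset.sum_cons]
  exact le_add_of_nonneg_right
    (sum_half_length_rpow_nonneg p fun J hJ => hnn J (Multiset.mem_cons_of_mem hJ))

theorem abs_sigmaN_sub_le_penaltyP_rpow (n : ℕ) (hp : 0 < p)
    (h₁ : ∀ I ∈ B₁, 0 ≤ I.2) (h₂ : ∀ I ∈ B₂, 0 ≤ I.2) (hM : IsMatching B₁ B₂ M) :
    |sigmaN n B₁ - sigmaN n B₂| ≤ n * (2 * penaltyP p B₁ B₂ M ^ p⁻¹) := by
  have hP : 0 ≤ penaltyP p B₁ B₂ M := penaltyP_nonneg h₁ h₂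
  have hε : 0 ≤ 2 * penaltyP p B₁ B₂ M ^ p⁻¹ := by positivity
  have hmatched : ∀ IJ ∈ M, |IJ.1.2 - IJ.2.2| ≤ 2 * penaltyP p B₁ B₂ M ^ p⁻¹ := by
    intro IJ hIJ
    refine (abs_snd_sub_snd_le_two_mul_intervalDist _ _).trans ?_
    gcongr
    exact (Real.le_rpow_inv_iff_of_pos (intervalDist_nonneg _ _) hP hp).2
      (intervalDist_rpow_le_penaltyP h₁ h₂ hIJ)
  have hunmatched : ∀ I ∈ (B₁ - M.map Prod.fst) + (B₂ - M.map Prod.snd),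
      I.2 ≤ 2 * penaltyP p B₁ B₂ M ^ p⁻¹ := by
    intro I hI
    have hI0 := snd_nonneg_of_mem_unmatched h₁ h₂ I hI
    have := (Real.le_rpow_inv_iff_of_pos (by positivity) hP hp).2
      (half_length_rpow_le_penaltyP h₁ h₂ hI)
    linarith
  have h₁₂ : sigmaN n B₁ ≤ sigmaN n B₂ + n * (2 * penaltyP p B₁ B₂ M ^ p⁻¹) := by
    refine sigmaN_le_add_of_isMatching hM hε (fun IJ hIJ => ?_)
      fun I hI => hunmatched I (Multiset.mem_add.2 (Or.inl hI))
    linarith [(abs_le.1 (hmatched IJ hIJ)).2]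
  have h₂₁ : sigmaN n B₂ ≤ sigmaN n B₁ + n * (2 * penaltyP p B₁ B₂ M ^ p⁻¹) := by
    refine sigmaN_le_add_of_isMatching hM.swap hε (fun JI hJI => ?_) fun I hI => ?_
    · obtain ⟨IJ, hIJ, rfl⟩ := Multiset.mem_map.1 hJI
      simp only [Prod.fst_swap, Prod.snd_swap]
      linarith [(abs_le.1 (hmatched IJ hIJ)).1]
    · rw [Multiset.map_map] at hI
      exact hunmatched I (Multiset.mem_add.2 (Or.inr hI))
  rw [abs_le]
  constructor <;> linarith

theorem wassersteinDist_nonneg (h₁ : ∀ I ∈ B₁, 0 ≤ I.2) (h₂ : ∀ I ∈ B₂, 0 ≤ I.2) :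
    0 ≤ wassersteinDist p B₁ B₂ := by
  refine Real.rpow_nonneg (Real.sInf_nonneg ?_) _
  rintro _ ⟨M, -, rfl⟩
  exact penaltyP_nonneg h₁ h₂

/-- A bound by the `p`-th root of every penalty is a bound by the Wasserstein distance. -/
theorem le_wassersteinDist {x : ℝ} (hx : 0 ≤ x) (hp : 0 < p)
    (h₁ : ∀ I ∈ B₁, 0 ≤ I.2) (h₂ : ∀ I ∈ B₂, 0 ≤ I.2)
    (h : ∀ M, IsMatching B₁ B₂ M → x ≤ penaltyP p B₁ B₂ M ^ p⁻¹) :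
    x ≤ wassersteinDist p B₁ B₂ := by
  rw [wassersteinDist, one_div]
  have hnn : 0 ≤ sInf { r | ∃ M, IsMatching B₁ B₂ M ∧ r = penaltyP p B₁ B₂ M } := by
    refine Real.sInf_nonneg ?_
    rintro _ ⟨M, -, rfl⟩
    exact penaltyP_nonneg h₁ h₂
  rw [Real.le_rpow_inv_iff_of_pos hx hnn hp]
  refine le_csInf ⟨_, 0, ⟨by simp, by simp⟩, rfl⟩ ?_
  rintro _ ⟨M, hM, rfl⟩
  exact (Real.le_rpow_inv_iff_of_pos hx (penaltyP_nonneg h₁ h₂) hp).1 (h M hM)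

theorem abs_sigmaN_sub_le_wassersteinDist {n : ℕ} (hn : 1 ≤ n) (hp : 0 < p)
    (h₁ : ∀ I ∈ B₁, 0 ≤ I.2) (h₂ : ∀ I ∈ B₂, 0 ≤ I.2) :
    |sigmaN n B₁ - sigmaN n B₂| ≤ 2 * n * wassersteinDist p B₁ B₂ := by
  have hn0 : (0 : ℝ) < 2 * n := by positivity
  rw [← div_le_iff₀' hn0]
  refine le_wassersteinDist (by positivity) hp h₁ h₂ fun M hM => ?_
  rw [div_le_iff₀' hn0]
  linarith [abs_sigmaN_sub_le_penaltyP_rpow n hp h₁ h₂ hM]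

end Penalty

/-- Wasserstein stability of max-plus polynomials on the barcode space. -/
theorem maxplus_wasserstein_stability (F : Barcode → ℝ) (hF : MemD F) (p : ℝ) (hp : 1 ≤ p) :
    ∃ C : ℝ, 0 ≤ C ∧ ∀ B₁ B₂ : Barcode,
      |F B₁ - F B₂| ≤ C * wassersteinDist p B₁.1 B₂.1 := by
  have hd : ∀ B₁ B₂ : Barcode, 0 ≤ wassersteinDist p B₁.1 B₂.1 := fun B₁ B₂ =>
    wassersteinDist_nonneg (fun I hI => (B₁.2 I hI).2) (fun I hI => (B₂.2 I hI).2)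
  induction hF with
  | const c => exact ⟨0, le_rfl, by simp⟩
  | sigma n hn =>
    exact ⟨2 * n, by positivity, fun B₁ B₂ => abs_sigmaN_sub_le_wassersteinDist hn (by linarith)
      (fun I hI => (B₁.2 I hI).2) (fun I hI => (B₂.2 I hI).2)⟩
  | @add f g _ _ hf hg =>
    obtain ⟨C, hC, hf⟩ := hf
    obtain ⟨D, hD, hg⟩ := hg
    refine ⟨C + D, by positivity, fun B₁ B₂ => ?_⟩
    rw [add_sub_add_comm, add_mul]
    exact (abs_add_le _ _).trans (add_le_add (hf B₁ B₂) (hg B₁ B₂))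
  | @max f g _ _ hf hg =>
    obtain ⟨C, hC, hf⟩ := hf
    obtain ⟨D, hD, hg⟩ := hg
    refine ⟨max C D, le_max_of_le_left hC, fun B₁ B₂ => ?_⟩
    refine (abs_max_sub_max_le_max _ _ _ _).trans (max_le ?_ ?_)
    · exact (hf B₁ B₂).trans (mul_le_mul_of_nonneg_right (le_max_left _ _) (hd B₁ B₂))
    · exact (hg B₁ B₂).trans (mul_le_mul_of_nonneg_right (le_max_right _ _) (hd B₁ B₂))
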